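/- arXiv:2106.00514 — 2 statements merged into one kernel-verified Lean document; each statement's English description precedes it below -/
import Mathlib

section
/- Let S_n ∼ Bin(n, 1/2) and let Ŝ_n = (S_n − n/2)/√n be the standardised sum. Then for all n ≥ 2, D(Ŝ_n) ≤ 8/√n, where D(Ŝ_n) is the relative entropy between the probability mass function of Ŝ_n and the Gaussian with the same mean and variance quantised on the lattice {k/√n − √n/2 : k ∈ ℤ}. -/
open MeasureTheory Real

noncomputable section

/-- The density of a `N(m, v)` Gaussian. -/
def gaussDensity (m v x : ℝ) : ℝ :=
  (Real.sqrt (2 * Real.pi * v))⁻¹ * Real.exp (-(x - m) ^ 2 / (2 * v))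

/-- The probability mass function of the standardised binomial `Ŝ_n = (S_n − n/2)/√n`,
`S_n ∼ Bin(n, 1/2)`, read off on the lattice `{k/√n − √n/2 : k ∈ ℤ}`: the value at the
lattice point indexed by `k` is `C(n,k) 2^{−n}` for `0 ≤ k ≤ n` and `0` otherwise. -/
def binStdPmf (n : ℕ) (k : ℤ) : ℝ :=
  if 0 ≤ k ∧ k ≤ (n : ℤ) then (n.choose k.toNat : ℝ) * (1 / 2) ^ n else 0

/-- The relative entropy `D(Ŝ_n)` between the probability mass function of the
standardised binomial `Ŝ_n` (mean `0`, variance `1/4`) and the `N(0, 1/4)` Gaussian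
quantised on the lattice `{k/√n − √n/2 : k ∈ ℤ}` (span `1/√n`). -/
def binStdD (n : ℕ) : ℝ :=
  ∑' k : ℤ, binStdPmf n k *
    Real.log (binStdPmf n k /
      ∫ x in ((k : ℝ) / Real.sqrt n - Real.sqrt n / 2)..
          (((k : ℝ) + 1) / Real.sqrt n - Real.sqrt n / 2),
        gaussDensity 0 (1 / 4) x)

lemma sum_choose_half (n : ℕ) :
    ∑ k ∈ Finset.range (n + 1), (n.choose k : ℝ) * (1 / 2) ^ n = 1 := by
  rw [← Finset.sum_mul, ← Nat.cast_sum, Nat.sum_range_choose]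
  push_cast
  rw [← mul_pow]
  norm_num

lemma bernstein_eval_half {n k : ℕ} (hk : k ∈ Finset.range (n + 1)) :
    (bernsteinPolynomial ℝ n k).eval (1 / 2) = (n.choose k : ℝ) * (1 / 2) ^ n := by
  have hkn : k ≤ n := by simpa [Nat.lt_succ_iff] using hk
  have h : ((1 : ℝ) / 2) ^ n = (1 / 2) ^ k * (1 / 2) ^ (n - k) := by
    rw [← pow_add, Nat.add_sub_cancel' hkn]
  rw [h]
  simp only [bernsteinPolynomial, Polynomial.eval_mul, Polynomial.eval_natCast,
    Polynomial.eval_pow, Polynomial.eval_X, Polynomial.eval_sub, Polynomial.eval_one]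
  norm_num [mul_assoc]

lemma sum_sub_mul_choose_half (n : ℕ) :
    ∑ k ∈ Finset.range (n + 1), ((k : ℝ) - n / 2) * ((n.choose k : ℝ) * (1 / 2) ^ n) = 0 := by
  have h := congrArg (Polynomial.eval (1 / 2 : ℝ)) (bernsteinPolynomial.sum_smul ℝ n)
  simp only [Polynomial.eval_finsetSum, nsmul_eq_mul, Polynomial.eval_mul,
    Polynomial.eval_natCast, Polynomial.eval_X] at h
  rw [Finset.sum_congr rfl fun k hk => by rw [bernstein_eval_half hk]] at h
  simp only [sub_mul, Finset.sum_sub_distrib, h, ← Finset.mul_sum, sum_choose_half]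
  ring

lemma sum_sq_mul_choose_half (n : ℕ) :
    ∑ k ∈ Finset.range (n + 1), ((k : ℝ) - n / 2) ^ 2 * ((n.choose k : ℝ) * (1 / 2) ^ n)
      = (n : ℝ) / 4 := by
  have h := congrArg (Polynomial.eval (1 / 2 : ℝ)) (bernsteinPolynomial.variance ℝ n)
  simp only [Polynomial.eval_finsetSum, nsmul_eq_mul, Polynomial.eval_mul, Polynomial.eval_pow,
    Polynomial.eval_sub, Polynomial.eval_natCast, Polynomial.eval_X, Polynomial.eval_one] at h
  rw [Finset.sum_congr rfl fun k hk => by rw [bernstein_eval_half hk]] at h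
  rw [show (n : ℝ) / 4 = (n : ℝ) * (1 / 2) * (1 - 1 / 2) by ring, ← h]
  exact Finset.sum_congr rfl fun k _ => by ring

lemma one_sub_le_one_add_mul_exp {u : ℝ} (h0 : 0 ≤ u) (h1 : u ≤ 1) :
    1 - u ≤ (1 + u) * exp (-(2 * u)) := by
  rcases h1.eq_or_lt with rfl | h1
  · norm_num; positivity
  have h := Real.sum_range_le_log_div h0 h1 1
  have hpos : 0 < 1 - u := by linarith
  have h' : 2 * u ≤ log ((1 + u) / (1 - u)) := by
    simp at h; linarith
  rw [Real.le_log_iff_exp_le (by positivity), le_div_iff₀ hpos] at h'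
  rw [Real.exp_neg, ← div_eq_mul_inv, le_div_iff₀ (exp_pos _)]
  linarith

/-- The binomial coefficients decay at least like the Gaussian of variance `(n + 1) / 4`
to the right of the middle. -/
lemma choose_succ_mul_exp_le {n k : ℕ} (hk : n ≤ 2 * k + 1) (hkn : k ≤ n) :
    (n.choose (k + 1) : ℝ) * exp (2 * ((k : ℝ) + 1 - n / 2) ^ 2 / (n + 1))
      ≤ n.choose k * exp (2 * ((k : ℝ) - n / 2) ^ 2 / (n + 1)) := by
  have hn : (0 : ℝ) < n + 1 := by positivity
  have hkR : (n : ℝ) ≤ 2 * k + 1 := by exact_mod_cast hk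
  have hknR : (k : ℝ) ≤ n := by exact_mod_cast hkn
  set u : ℝ := (2 * k + 1 - n) / (n + 1) with hu
  have hun : u * (n + 1) = 2 * k + 1 - n := by rw [hu]; field_simp
  have h0 : 0 ≤ u := div_nonneg (by linarith) hn.le
  have h1 : u ≤ 1 := by rw [hu, div_le_one hn]; linarith
  have hrec : (n.choose (k + 1) : ℝ) * (k + 1) = n.choose k * (n - k) := by
    have h := congrArg (Nat.cast : ℕ → ℝ) (Nat.choose_succ_right_eq n k)
    push_cast [Nat.cast_sub hkn] at h
    exact h
  have hstep : (n.choose (k + 1) : ℝ) ≤ n.choose k * exp (-(2 * u)) := by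
    have hk1 : (0 : ℝ) < k + 1 := by positivity
    refine le_of_mul_le_mul_right ?_ hk1
    have h := one_sub_le_one_add_mul_exp h0 h1
    have h' : (n : ℝ) - k ≤ (k + 1) * exp (-(2 * u)) := by
      have h2 := mul_le_mul_of_nonneg_left h (by positivity : (0 : ℝ) ≤ (n + 1) / 2)
      calc (n : ℝ) - k = (n + 1) / 2 * (1 - u) := by linarith
        _ ≤ _ := h2
        _ = ((n + 1) / 2 * (1 + u)) * exp (-(2 * u)) := by ring
        _ = _ := by congr 1; linarith
    calc _ = n.choose k * ((n : ℝ) - k) := hrec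
      _ ≤ n.choose k * ((k + 1) * exp (-(2 * u))) := by gcongr
      _ = _ := by ring
  calc _ ≤ n.choose k * exp (-(2 * u)) * exp (2 * ((k : ℝ) + 1 - n / 2) ^ 2 / (n + 1)) := by
        gcongr
    _ = _ := by
        rw [mul_assoc, ← Real.exp_add]
        congr 2
        rw [hu]; field_simp; ring

lemma centralBinom_le (m : ℕ) (hm : 0 < m) :
    (m.centralBinom : ℝ) * (1 / 2) ^ (2 * m) ≤ sqrt (1 / (π * m)) := by
  have hmR : (0 : ℝ) < m := by exact_mod_cast hm
  apply Real.le_sqrt_of_sq_le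
  have hW := Real.Wallis.le_W m
  rw [Real.Wallis.W_eq_factorial_ratio] at hW
  have hc : (m.centralBinom : ℝ) * (m.factorial : ℝ) ^ 2 = (2 * m).factorial := by
    have h := Nat.choose_mul_factorial_mul_factorial (n := 2 * m) (k := m) (by omega)
    rw [show 2 * m - m = m by omega] at h
    rw [Nat.centralBinom, ← h]
    push_cast; ring
  have hcpos : (0 : ℝ) < m.centralBinom := by exact_mod_cast m.centralBinom_pos
  have hf : (0 : ℝ) < (m.factorial : ℝ) := by positivity
  rw [← hc, show (2 : ℝ) ^ (4 * m) = (2 ^ (2 * m)) ^ 2 by ring] at hW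
  set P : ℝ := 2 ^ (2 * m)
  have hP : 0 < P := by positivity
  have hpi := Real.pi_pos
  have e : P ^ 2 * (m.factorial : ℝ) ^ 4 / ((m.centralBinom * (m.factorial : ℝ) ^ 2) ^ 2
      * (2 * m + 1)) = P ^ 2 / (m.centralBinom ^ 2 * (2 * m + 1)) := by
    field_simp
  rw [e, div_mul_div_comm, div_le_div_iff₀ (by positivity) (by positivity)] at hW
  rw [one_div_pow, mul_one_div, div_pow, div_le_div_iff₀ (by positivity) (by positivity)]
  have hx : (0 : ℝ) ≤ (m.centralBinom : ℝ) ^ 2 * π := by positivity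
  refine le_of_mul_le_mul_right ?_ (by positivity : (0 : ℝ) < 4 * (m + 1))
  nlinarith [hW, hx]

lemma choose_middle_le (n : ℕ) (hn : 0 < n) :
    (n.choose ((n + 1) / 2) : ℝ) * (1 / 2) ^ n ≤ sqrt (2 / (π * n)) := by
  have hpi := Real.pi_pos
  rcases Nat.even_or_odd' n with ⟨m, rfl | rfl⟩
  · have h := centralBinom_le m (by omega)
    rw [show (2 * m + 1) / 2 = m by omega, ← Nat.centralBinom]
    convert h using 2
    push_cast
    rw [mul_left_comm, div_mul_eq_div_div, div_self two_ne_zero]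
  · have h := centralBinom_le (m + 1) (by omega)
    have e : (m + 1).centralBinom = 2 * (2 * m + 1).choose (m + 1) := by
      rw [Nat.centralBinom, show 2 * (m + 1) = (2 * m + 1) + 1 by ring, Nat.choose_succ_succ,
        Nat.choose_symm_half]
      ring
    rw [show (2 * m + 1 + 1) / 2 = m + 1 by omega]
    rw [e] at h
    calc _ = ((2 * (2 * m + 1).choose (m + 1) : ℕ) : ℝ) * (1 / 2) ^ (2 * (m + 1)) := by
          push_cast; ring
      _ ≤ _ := h
      _ ≤ _ := by
          apply Real.sqrt_le_sqrt
          rw [div_le_div_iff₀ (by positivity) (by positivity)]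
          push_cast
          nlinarith

lemma choose_half_le_of_middle_le {n : ℕ} (hn : 0 < n) {k : ℕ} (hk : (n + 1) / 2 ≤ k)
    (hkn : k ≤ n) :
    (n.choose k : ℝ) * (1 / 2) ^ n ≤ sqrt (2 / (π * n)) *
      exp (1 / (2 * (n + 1)) - 2 * ((k : ℝ) - n / 2) ^ 2 / (n + 1)) := by
  have hn1 : (0 : ℝ) < n + 1 := by positivity
  have key : (n.choose k : ℝ) * exp (2 * ((k : ℝ) - n / 2) ^ 2 / (n + 1))
      ≤ n.choose ((n + 1) / 2) * exp (1 / (2 * (n + 1))) := by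
    revert hkn
    induction k, hk using Nat.le_induction with
    | base =>
      intro _
      have h : ((((n + 1) / 2 : ℕ) : ℝ) - (n : ℝ) / 2) ^ 2 ≤ 1 / 4 := by
        rcases Nat.even_or_odd' n with ⟨m, rfl | rfl⟩
        · rw [show (2 * m + 1) / 2 = m by omega]
          push_cast; ring_nf; norm_num
        · rw [show (2 * m + 1 + 1) / 2 = m + 1 by omega]
          push_cast; ring_nf; norm_num
      have h' : 2 * ((((n + 1) / 2 : ℕ) : ℝ) - (n : ℝ) / 2) ^ 2 / (n + 1) ≤ 1 / (2 * (n + 1)) := by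
        rw [div_le_div_iff₀ hn1 (by positivity)]
        nlinarith
      gcongr
    | succ k hk ih =>
      intro hkn
      refine le_trans ?_ (ih (by omega))
      push_cast
      exact choose_succ_mul_exp_le (by omega) (by omega)
  rw [Real.exp_sub, ← mul_div_assoc, le_div_iff₀ (exp_pos _)]
  calc _ = (n.choose k : ℝ) * exp (2 * ((k : ℝ) - n / 2) ^ 2 / (n + 1)) * (1 / 2) ^ n := by ring
    _ ≤ n.choose ((n + 1) / 2) * exp (1 / (2 * (n + 1))) * (1 / 2) ^ n := by gcongr
    _ = n.choose ((n + 1) / 2) * (1 / 2) ^ n * exp (1 / (2 * (n + 1))) := by ring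
    _ ≤ _ := by gcongr; exact choose_middle_le n hn

/-- A Gaussian upper bound, with sharp leading constant, for the weights of `Bin(n, 1/2)`. -/
lemma choose_half_le {n : ℕ} (hn : 0 < n) {k : ℕ} (hkn : k ≤ n) :
    (n.choose k : ℝ) * (1 / 2) ^ n ≤ sqrt (2 / (π * n)) *
      exp (1 / (2 * (n + 1)) - 2 * ((k : ℝ) - n / 2) ^ 2 / (n + 1)) := by
  rcases le_or_gt ((n + 1) / 2) k with hk | hk
  · exact choose_half_le_of_middle_le hn hk hkn
  · have h := choose_half_le_of_middle_le hn (k := n - k) (by omega) (by omega)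
    rw [Nat.choose_symm hkn, Nat.cast_sub hkn,
      show ((n : ℝ) - k - n / 2) ^ 2 = (k - n / 2) ^ 2 by ring] at h
    exact h

/-- Jensen's inequality for the exponential of a quadratic on an interval. -/
lemma mul_exp_le_integral_exp (a h : ℝ) (hh : 0 ≤ h) :
    h * exp (-(2 * (a ^ 2 + a * h + h ^ 2 / 3))) ≤ ∫ x in a..a + h, exp (-(2 * x ^ 2)) := by
  set M : ℝ := -(2 * (a ^ 2 + a * h + h ^ 2 / 3)) with hM
  have hint : ∫ x in a..a + h, exp M * (1 - M - 2 * x ^ 2) = h * exp M := by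
    rw [intervalIntegral.integral_const_mul, intervalIntegral.integral_sub
      (by simp) (Continuous.intervalIntegrable (by fun_prop) _ _),
      intervalIntegral.integral_const_mul, integral_pow, intervalIntegral.integral_const]
    rw [smul_eq_mul, hM]
    push_cast
    ring
  rw [← hint]
  refine intervalIntegral.integral_mono_on (by linarith)
    (Continuous.intervalIntegrable (by fun_prop) _ _)
    (Continuous.intervalIntegrable (by fun_prop) _ _) fun x _ => ?_
  have h1 := Real.add_one_le_exp (-(2 * x ^ 2) - M)
  calc exp M * (1 - M - 2 * x ^ 2) ≤ exp M * exp (-(2 * x ^ 2) - M) := by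
        gcongr; linarith
    _ = _ := by rw [← Real.exp_add]; congr 1; ring

/-- Jensen lower bound for the mass the quantised Gaussian puts on a lattice point. -/
lemma le_integral_gaussDensity {n : ℕ} (hn : 0 < n) (k : ℝ) :
    sqrt (2 / (π * n)) * exp (-(2 * ((k - n / 2) ^ 2 + (k - n / 2) + 1 / 3) / n)) ≤
      ∫ x in (k / sqrt n - sqrt n / 2)..((k + 1) / sqrt n - sqrt n / 2),
        gaussDensity 0 (1 / 4) x := by
  have hnR : (0 : ℝ) < n := by exact_mod_cast hn
  have hs : 0 < sqrt (n : ℝ) := Real.sqrt_pos.2 hnR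
  have hsq : sqrt (n : ℝ) ^ 2 = n := Real.sq_sqrt hnR.le
  have hJ := mul_exp_le_integral_exp (k / sqrt n - sqrt n / 2) (1 / sqrt n) (by positivity)
  have hd : ∀ x, gaussDensity 0 (1 / 4) x = (sqrt (2 * π * (1 / 4)))⁻¹ * exp (-(2 * x ^ 2)) := by
    intro x
    unfold gaussDensity
    congr 2
    ring
  simp only [hd]
  rw [intervalIntegral.integral_const_mul, show (k + 1) / sqrt n - sqrt n / 2
    = k / sqrt n - sqrt n / 2 + 1 / sqrt n by ring]
  have hc : sqrt (2 / (π * n)) = (sqrt (2 * π * (1 / 4)))⁻¹ * (1 / sqrt n) := by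
    rw [one_div (sqrt _), ← mul_inv, ← Real.sqrt_mul (by positivity), ← Real.sqrt_inv]
    congr 1
    have := Real.pi_pos
    field_simp
    norm_num
  have hx : k / sqrt n - sqrt n / 2 = (k - n / 2) / sqrt n := by
    field_simp
    rw [hsq]
  have he : 2 * ((k / sqrt n - sqrt n / 2) ^ 2 + (k / sqrt n - sqrt n / 2) * (1 / sqrt n)
      + (1 / sqrt n) ^ 2 / 3) = 2 * ((k - n / 2) ^ 2 + (k - n / 2) + 1 / 3) / n := by
    rw [hx, div_pow, div_mul_div_comm, ← sq, div_pow, hsq]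
    ring
  rw [he] at hJ
  rw [hc, mul_assoc]
  gcongr

lemma binStdD_le {n : ℕ} (hn : 0 < n) : binStdD n ≤ 1 / (n + 1) + 2 / (3 * n) := by
  have hnR : (0 : ℝ) < n := by exact_mod_cast hn
  have hpi := Real.pi_pos
  have hsupp : ∀ f : ℤ → ℝ, ∑' k : ℤ, binStdPmf n k * f k
      = ∑ k ∈ Finset.range (n + 1), (n.choose k : ℝ) * (1 / 2) ^ n * f k := by
    intro f
    rw [tsum_eq_sum (s := (Finset.range (n + 1)).map Nat.castEmbedding), Finset.sum_map]
    · refine Finset.sum_congr rfl fun k hk => ?_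
      have : k ≤ n := by simpa [Nat.lt_succ_iff] using hk
      simp [binStdPmf, this]
    · intro k hk
      have : ¬ (0 ≤ k ∧ k ≤ (n : ℤ)) := fun h => hk <| by
        rw [Finset.mem_map]
        exact ⟨k.toNat, by rw [Finset.mem_range]; omega, by simp [h.1]⟩
      simp [binStdPmf, this]
  unfold binStdD
  rw [hsupp]
  have hterm : ∀ k ∈ Finset.range (n + 1), (n.choose k : ℝ) * (1 / 2) ^ n *
      Real.log (binStdPmf n k / ∫ x in (((k : ℤ) : ℝ) / Real.sqrt n - Real.sqrt n / 2)..
          ((((k : ℤ) : ℝ) + 1) / Real.sqrt n - Real.sqrt n / 2), gaussDensity 0 (1 / 4) x)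
      ≤ (1 / (2 * (n + 1)) + 2 / (3 * n)) * ((n.choose k : ℝ) * (1 / 2) ^ n)
        + 2 / n * (((k : ℝ) - n / 2) * ((n.choose k : ℝ) * (1 / 2) ^ n))
        + (2 / n - 2 / (n + 1)) *
          (((k : ℝ) - n / 2) ^ 2 * ((n.choose k : ℝ) * (1 / 2) ^ n)) := by
    intro k hk
    have hkn : k ≤ n := by simpa [Nat.lt_succ_iff] using hk
    have hb : binStdPmf n k = (n.choose k : ℝ) * (1 / 2) ^ n := by simp [binStdPmf, hkn]
    have hbpos : 0 < (n.choose k : ℝ) * (1 / 2) ^ n := by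
      have := Nat.choose_pos hkn
      positivity
    have hup := choose_half_le hn hkn
    have hlow := le_integral_gaussDensity hn (k : ℝ)
    rw [hb, Int.cast_natCast]
    set b : ℝ := (n.choose k : ℝ) * (1 / 2) ^ n
    set q : ℝ := ∫ x in ((k : ℝ) / Real.sqrt n - Real.sqrt n / 2)..
          (((k : ℝ) + 1) / Real.sqrt n - Real.sqrt n / 2), gaussDensity 0 (1 / 4) x
    set c : ℝ := sqrt (2 / (π * n))
    have hc : 0 < c := Real.sqrt_pos.2 (by positivity)
    have hq : 0 < q := lt_of_lt_of_le (by positivity) hlow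
    have hlb := Real.log_le_log hbpos hup
    have hlq := Real.log_le_log (by positivity) hlow
    rw [Real.log_mul hc.ne' (exp_pos _).ne', Real.log_exp] at hlb hlq
    rw [Real.log_div hbpos.ne' hq.ne']
    calc b * (log b - log q) ≤ b * ((1 / (2 * (n + 1)) - 2 * ((k : ℝ) - n / 2) ^ 2 / (n + 1))
          + 2 * (((k : ℝ) - n / 2) ^ 2 + ((k : ℝ) - n / 2) + 1 / 3) / n) := by
          gcongr; linarith
      _ = _ := by field_simp; ring
  refine (Finset.sum_le_sum hterm).trans (le_of_eq ?_)
  rw [Finset.sum_add_distrib, Finset.sum_add_distrib, ← Finset.mul_sum, ← Finset.mul_sum,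
    ← Finset.mul_sum, sum_choose_half, sum_sub_mul_choose_half, sum_sq_mul_choose_half]
  field_simp
  ring

/-- If `S_n ∼ Bin(n, 1/2)` and `Ŝ_n = (S_n − n/2)/√n`, then for all `n ≥ 2`,
`D(Ŝ_n) ≤ 8/√n`. -/
theorem binomial_relative_entropy (n : ℕ) (hn : 2 ≤ n) :
    binStdD n ≤ 8 / Real.sqrt n := by
  have hnR : (1 : ℝ) ≤ n := by exact_mod_cast (by omega : 1 ≤ n)
  have hs : 1 ≤ sqrt (n : ℝ) := Real.one_le_sqrt.2 hnR
  have hsq : sqrt (n : ℝ) ^ 2 = n := Real.sq_sqrt (by linarith)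
  have hsn : sqrt (n : ℝ) ≤ n := by nlinarith
  calc binStdD n ≤ 1 / (n + 1) + 2 / (3 * n) := binStdD_le (by omega)
    _ ≤ 1 / n + 2 / n := by gcongr <;> linarith
    _ = 3 / n := by ring
    _ ≤ 8 / sqrt n := by gcongr; norm_num
end
end

section
/- Let n ≥ 2 be even and, for −n/2 ≤ k ≤ n/2, let a_k = C(n, n/2 + k) 2^{−n} denote the Bin(n, 1/2) probabilities centred at n/2. Then for all such k, a_k ≤ (πn/2)^{−1/2} · exp( −2k²/n ) · exp( 3|k|³/n² + 1/(12n) ). -/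
open Real

noncomputable section

/-- The central binomial probability is at most `(π m)^{-1/2}`. -/
lemma centralBinom_le_four_pow_div_sqrt {m : ℕ} (hm : m ≠ 0) :
    (m.centralBinom : ℝ) ≤ 4 ^ m * (√(π * m))⁻¹ := by
  have hm0 : (0 : ℝ) < m := by positivity
  have hpi : √π ≤ Stirling.stirlingSeq m := Stirling.sqrt_pi_le_stirlingSeq hm
  have hanti : Stirling.stirlingSeq (2 * m) ≤ Stirling.stirlingSeq m := by
    have h := Stirling.stirlingSeq'_antitone (show m - 1 ≤ 2 * m - 1 by omega)
    simp only [Function.comp_apply, Nat.succ_eq_add_one] at h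
    rwa [Nat.sub_add_cancel (by omega), Nat.sub_add_cancel (by omega)] at h
  have hpos : 0 < Stirling.stirlingSeq m := (by positivity : 0 < √π).trans_le hpi
  have hfact : (m.centralBinom : ℝ) * (m.factorial : ℝ) ^ 2 = ((2 * m).factorial : ℝ) := by
    have h := Nat.choose_mul_factorial_mul_factorial (show m ≤ 2 * m by omega)
    rw [show 2 * m - m = m by omega, ← Nat.centralBinom_eq_two_mul_choose] at h
    rw [← h]
    push_cast
    ring
  have key : (m.centralBinom : ℝ) =
      4 ^ m * Stirling.stirlingSeq (2 * m) / (Stirling.stirlingSeq m ^ 2 * √m) := by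
    have hsqrt : √(2 * ((2 * m : ℕ) : ℝ)) = 2 * √m := by
      rw [show 2 * ((2 * m : ℕ) : ℝ) = 2 ^ 2 * m by push_cast; ring,
        Real.sqrt_mul (by positivity), Real.sqrt_sq (by norm_num)]
    have hsq : √(2 * (m : ℝ)) ^ 2 = 2 * √m ^ 2 := by
      rw [Real.sq_sqrt (by positivity), Real.sq_sqrt hm0.le]
    have hpow : (((2 * m : ℕ) : ℝ) / exp 1) ^ (2 * m) = 4 ^ m * ((m / exp 1) ^ m) ^ 2 := by
      rw [← pow_mul, mul_comm m 2, pow_mul, pow_mul, ← mul_pow]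
      push_cast
      ring
    rw [Stirling.stirlingSeq, Stirling.stirlingSeq, hsqrt, hpow, ← hfact,
      div_pow (m.factorial : ℝ), mul_pow, hsq]
    field_simp
  rw [key, Real.sqrt_mul pi_pos.le, mul_div_assoc, inv_eq_one_div]
  refine mul_le_mul_of_nonneg_left ?_ (by positivity)
  rw [div_le_div_iff₀ (by positivity) (by positivity)]
  have h := mul_le_mul hanti hpi (by positivity) hpos.le
  nlinarith [mul_le_mul_of_nonneg_right h (Real.sqrt_nonneg (m : ℝ))]

/-- Gaussian decay of the binomial coefficients of order `2 m` away from the centre. -/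
lemma choose_two_mul_add_le_centralBinom_mul_exp (m k : ℕ) :
    ((2 * m).choose (m + k) : ℝ) ≤
      m.centralBinom * exp (-(2 * (k : ℝ) ^ 2 / (2 * m + 1))) := by
  induction k with
  | zero => simp [Nat.centralBinom_eq_two_mul_choose]
  | succ k ih =>
    rcases le_or_gt m k with hmk | hkm
    · rw [Nat.choose_eq_zero_of_lt (by omega)]
      simp only [Nat.cast_zero]
      positivity
    have hd : (0 : ℝ) < m - k := sub_pos.mpr (by exact_mod_cast hkm)
    have hstep : ((2 * m).choose (m + (k + 1)) : ℝ) * (m + k + 1) =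
        (2 * m).choose (m + k) * (m - k) := by
      have h := Nat.choose_succ_right_eq (2 * m) (m + k)
      rw [show 2 * m - (m + k) = m - k by omega] at h
      rw [← Nat.cast_sub hkm.le]
      exact_mod_cast h
    have hexp : exp (2 * (2 * k + 1) / (2 * m + 1)) ≤ (m + k + 1) / ((m : ℝ) - k) := by
      have h := Real.le_log_one_add_of_nonneg (x := (2 * k + 1) / ((m : ℝ) - k)) (by positivity)
      rw [Real.le_log_iff_exp_le (by positivity)] at h
      convert h using 1
      · congr 1
        rw [div_add' _ _ _ hd.ne', show 2 * (k : ℝ) + 1 + 2 * (m - k) = 2 * m + 1 by ring]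
        field_simp
      · field_simp
        ring
    have hratio : (m : ℝ) - k ≤ exp (-(2 * (2 * k + 1) / (2 * m + 1))) * (m + k + 1) := by
      rw [le_div_iff₀ hd] at hexp
      rw [exp_neg, inv_mul_eq_div, le_div_iff₀ (exp_pos _)]
      linarith
    refine le_of_mul_le_mul_right ?_ (show (0 : ℝ) < m + k + 1 by positivity)
    calc _ = ((2 * m).choose (m + k) : ℝ) * (m - k) := hstep
      _ ≤ (m.centralBinom * exp (-(2 * (k : ℝ) ^ 2 / (2 * m + 1)))) *
          (exp (-(2 * (2 * k + 1) / (2 * m + 1))) * (m + k + 1)) := by gcongr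
      _ = _ := by
        rw [← mul_assoc, mul_assoc (m.centralBinom : ℝ), ← exp_add]
        push_cast
        ring_nf

lemma choose_two_mul_add_toNat {m : ℕ} {k : ℤ} (hk : |k| ≤ m) :
    (2 * m).choose ((m : ℤ) + k).toNat = (2 * m).choose (m + k.natAbs) := by
  obtain ⟨hk₁, hk₂⟩ := abs_le.mp hk
  rcases le_total 0 k with h | h
  · congr 1
    omega
  · rw [← Nat.choose_symm (show m + k.natAbs ≤ 2 * m by omega)]
    congr 1
    omega

lemma neg_two_mul_sq_div_le {m : ℝ} (hm : 0 < m) (k : ℕ) :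
    -(2 * (k : ℝ) ^ 2 / (2 * m + 1)) ≤ -(k : ℝ) ^ 2 / m + 3 * (k : ℝ) ^ 3 / (4 * m ^ 2) := by
  have hcube : (k : ℝ) ^ 2 ≤ (k : ℝ) ^ 3 := by
    rcases Nat.eq_zero_or_pos k with rfl | hk
    · simp
    · exact_mod_cast Nat.pow_le_pow_right hk (by norm_num : 2 ≤ 3)
  have h1 : (k : ℝ) ^ 2 / m - 2 * (k : ℝ) ^ 2 / (2 * m + 1) ≤ (k : ℝ) ^ 2 / (2 * m ^ 2) := by
    rw [div_sub_div _ _ (by positivity) (by positivity),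
      div_le_div_iff₀ (by positivity) (by positivity)]
    nlinarith [mul_nonneg (sq_nonneg (k : ℝ)) hm.le]
  have h2 : (k : ℝ) ^ 2 / (2 * m ^ 2) ≤ 3 * (k : ℝ) ^ 3 / (4 * m ^ 2) := by
    rw [div_le_div_iff₀ (by positivity) (by positivity)]
    nlinarith [mul_le_mul_of_nonneg_right hcube (sq_nonneg m),
      mul_nonneg (sq_nonneg (k : ℝ)) (sq_nonneg m)]
  rw [neg_div]
  linarith

/-- For even `n ≥ 2` and `−n/2 ≤ k ≤ n/2`, the centred `Bin(n, 1/2)` probabilities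
`a_k = C(n, n/2 + k) 2^{−n}` satisfy
`a_k ≤ (πn/2)^{−1/2} exp(−2k²/n) exp(3|k|³/n² + 1/(12n))`. -/
theorem centred_binomial_pointwise_bound
    (n : ℕ) (hn : 2 ≤ n) (heven : Even n) (k : ℤ)
    (hk₁ : -((n : ℤ) / 2) ≤ k) (hk₂ : k ≤ (n : ℤ) / 2) :
    (n.choose ((n : ℤ) / 2 + k).toNat : ℝ) * (1 / 2) ^ n
      ≤ (Real.sqrt (Real.pi * n / 2))⁻¹ * Real.exp (-2 * (k : ℝ) ^ 2 / n)
        * Real.exp (3 * |(k : ℝ)| ^ 3 / n ^ 2 + 1 / (12 * n)) := by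
  obtain ⟨m, rfl⟩ := heven.exists_two_nsmul
  simp only [smul_eq_mul] at *
  have hm : m ≠ 0 := by omega
  have hm0 : (0 : ℝ) < m := by positivity
  have hhalf : ((2 * m : ℕ) : ℤ) / 2 = m := by omega
  rw [hhalf] at hk₁ hk₂ ⊢
  rw [choose_two_mul_add_toNat (abs_le.mpr ⟨hk₁, hk₂⟩)]
  have habs : |(k : ℝ)| = k.natAbs := by rw [Nat.cast_natAbs, Int.cast_abs]
  rw [← sq_abs (k : ℝ), habs, mul_assoc, ← exp_add]
  generalize k.natAbs = j
  have hpow : (1 / 2 : ℝ) ^ (2 * m) = (4 ^ m)⁻¹ := by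
    rw [pow_mul, ← inv_pow]
    norm_num
  have hcast : π * ((2 * m : ℕ) : ℝ) / 2 = π * m := by
    push_cast
    ring
  rw [hpow, hcast]
  have hexponent : -(2 * (j : ℝ) ^ 2 / (2 * m + 1)) ≤ -2 * (j : ℝ) ^ 2 / ((2 * m : ℕ) : ℝ) +
      (3 * (j : ℝ) ^ 3 / ((2 * m : ℕ) : ℝ) ^ 2 + 1 / (12 * ((2 * m : ℕ) : ℝ))) := by
    have h := neg_two_mul_sq_div_le hm0 j
    have hpos : 0 ≤ 1 / (12 * ((2 * m : ℕ) : ℝ)) := by positivity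
    have e1 : -2 * (j : ℝ) ^ 2 / ((2 * m : ℕ) : ℝ) = -(j : ℝ) ^ 2 / m := by
      push_cast
      field_simp
    have e2 : ((2 * m : ℕ) : ℝ) ^ 2 = 4 * (m : ℝ) ^ 2 := by
      push_cast
      ring
    rw [e1, e2]
    linarith
  calc ((2 * m).choose (m + j) : ℝ) * (4 ^ m)⁻¹
      ≤ (4 ^ m * (√(π * m))⁻¹) * exp (-(2 * (j : ℝ) ^ 2 / (2 * m + 1))) * (4 ^ m)⁻¹ := by
        gcongr
        refine (choose_two_mul_add_le_centralBinom_mul_exp m j).trans ?_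
        gcongr
        exact centralBinom_le_four_pow_div_sqrt hm
    _ = (√(π * m))⁻¹ * exp (-(2 * (j : ℝ) ^ 2 / (2 * m + 1))) := by field_simp
    _ ≤ _ := by gcongr
end
end
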